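/- arXiv:math/0510372 — 2 statements merged into one kernel-verified Lean document; each statement's English description precedes it below -/
import Mathlib

section
/- Let S be a semigroup with a zero element 0 such that the radical R(S) is a nilpotent semigroup. Then every maximal nilpotent subsemigroup of S (i.e., every maximal element of the set of nilpotent subsemigroups of S partially ordered by inclusion) contains R(S). In particular, R(S) is contained in the intersection of all maximal nilpotent subsemigroups of S. -/
/-! Basic notions for nilpotent subsemigroups of a semigroup with zero,
following Ganyushkin–Mazorchuk, "On classification of maximal nilpotent
subsemigroups". -/

/-- The product `a * l₀ * l₁ * ⋯` of a nonempty list of semigroup elements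
(the element `a` followed by the elements of the list `l`). -/
def prodl {S : Type*} [Mul S] (a : S) (l : List S) : S := l.foldl (· * ·) a

/-- `T` is a subsemigroup of `S`, i.e. closed under multiplication. -/
def IsSubsgp {S : Type*} [Mul S] (T : Set S) : Prop :=
  ∀ ⦃a b : S⦄, a ∈ T → b ∈ T → a * b ∈ T

/-- Every product of `k` elements of `T` equals `0`. -/
def ProdZero {S : Type*} [Mul S] [Zero S] (T : Set S) (k : ℕ) : Prop :=
  ∀ (a : S) (l : List S), a ∈ T → (∀ x ∈ l, x ∈ T) → l.length + 1 = k →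
    prodl a l = 0

/-- `T` is a nilpotent subsemigroup: it is closed under multiplication and some
positive power of it vanishes. -/
def IsNilpSubsgp {S : Type*} [Mul S] [Zero S] (T : Set S) : Prop :=
  IsSubsgp T ∧ ∃ k : ℕ, 1 ≤ k ∧ ProdZero T k

/-- `k` is the nilpotency class of `T`: the least positive integer such that
every product of `k` elements of `T` equals `0`. -/
def NilpClass {S : Type*} [Mul S] [Zero S] (T : Set S) (k : ℕ) : Prop :=
  1 ≤ k ∧ ProdZero T k ∧ ∀ m : ℕ, 1 ≤ m → ProdZero T m → k ≤ m

/-- `T` is a maximal nilpotent subsemigroup of `S`: a maximal element of the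
set of nilpotent subsemigroups of `S` ordered by inclusion. -/
def IsMaxNilpSubsgp {S : Type*} [Mul S] [Zero S] (T : Set S) : Prop :=
  IsNilpSubsgp T ∧ ∀ T' : Set S, IsNilpSubsgp T' → T ⊆ T' → T' = T

/-- The principal left ideal `S¹a = {a} ∪ Sa`. -/
def lId {S : Type*} [Mul S] (a : S) : Set S := insert a {x | ∃ u, x = u * a}

/-- The principal right ideal `aS¹ = {a} ∪ aS`. -/
def rId {S : Type*} [Mul S] (a : S) : Set S := insert a {x | ∃ v, x = a * v}

/-- The principal two-sided ideal `(a) = S¹aS¹ = {a} ∪ Sa ∪ aS ∪ SaS`. -/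
def pId {S : Type*} [Mul S] (a : S) : Set S :=
  insert a ({x | ∃ u, x = u * a} ∪ {x | ∃ v, x = a * v} ∪ {x | ∃ u v, x = u * a * v})

/-- The radical `R(S)`: the set of `x ∈ S` such that the subsemigroup
`(x) = S¹xS¹` is nilpotent. -/
def radical (S : Type*) [Mul S] [Zero S] : Set S :=
  {x | ∃ k : ℕ, 1 ≤ k ∧ ProdZero (pId x) k}

/-- The J(=D for finite semigroups)-class of `a` is a minimal nonzero class:
`a ≠ 0` and every principal ideal contained in `(a)` is either `{0}` or equals
`(a)`. -/
def InMinClass {S : Type*} [Mul S] [Zero S] (a : S) : Prop :=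
  a ≠ 0 ∧ ∀ b : S, pId b ⊆ pId a → b = 0 ∨ pId b = pId a

/-- A minimal idempotent: a nonzero idempotent lying in a minimal D-class. -/
def MinIdem {S : Type*} [Mul S] [Zero S] (e : S) : Prop :=
  e * e = e ∧ InMinClass e

theorem prodl_append_cons {S : Type*} [Semigroup S] (a b : S) (l r : List S) :
    prodl a (l ++ b :: r) = prodl a l * prodl b r := by
  have key : ∀ (r : List S) (x y : S), prodl (x * y) r = x * prodl y r := by
    intro r
    induction r with
    | nil => intro x y; rfl
    | cons c r ih =>
      intro x y
      change prodl (x * y * c) r = x * prodl (y * c) r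
      rw [mul_assoc, ih]
  rw [← key]
  simp [prodl]

/-- If all products of `m` elements of `A` lie in `B`, then a product of `(k + 1) * m` elements
of `A` is a product of `k + 1` elements of `B`. -/
theorem exists_prodl_eq_of_blocks {S : Type*} [Semigroup S] {A B : Set S} {m : ℕ}
    (hm : 1 ≤ m)
    (hAB : ∀ (a : S) (l : List S), a ∈ A → (∀ x ∈ l, x ∈ A) → l.length + 1 = m →
      prodl a l ∈ B) (k : ℕ) :
    ∀ (a : S) (l : List S), a ∈ A → (∀ x ∈ l, x ∈ A) → l.length + 1 = (k + 1) * m →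
      ∃ (b : S) (l' : List S), b ∈ B ∧ (∀ x ∈ l', x ∈ B) ∧ l'.length = k ∧
        prodl a l = prodl b l' := by
  induction k with
  | zero =>
    intro a l ha hl hlen
    exact ⟨prodl a l, [], hAB a l ha hl (by simpa using hlen), by simp, rfl, rfl⟩
  | succ k ih =>
    intro a l ha hl hlen
    have hmul : (k + 1 + 1) * m = (k + 1) * m + m := by ring
    have hle : m ≤ (k + 1) * m := Nat.le_mul_of_pos_left m k.succ_pos
    have hsplit := List.take_append_drop (m - 1) l
    have htake : (l.take (m - 1)).length + 1 = m := by
      rw [List.length_take]; omega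
    have hdrop : (l.drop (m - 1)).length = (k + 1) * m := by
      rw [List.length_drop]; omega
    generalize l.take (m - 1) = p at hsplit htake
    generalize l.drop (m - 1) = q at hsplit hdrop
    subst hsplit
    cases q with
    | nil => simp only [List.length_nil] at hdrop; omega
    | cons c r =>
      obtain ⟨b, l', hb, hl', hlen', hprod⟩ := ih c r (hl c (by simp))
        (fun x hx => hl x (by simp [hx])) (by simpa using hdrop)
      refine ⟨prodl a p, b :: l', hAB a p ha (fun x hx => hl x (by simp [hx])) htake, ?_,
        by simp [hlen'], ?_⟩
      · simpa using ⟨hb, hl'⟩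
      · rw [prodl_append_cons, hprod]
        exact (prodl_append_cons _ b [] l').symm

theorem ProdZero.mono {S : Type*} [Mul S] [Zero S] {A B : Set S} {k : ℕ}
    (hB : ProdZero B k) (h : A ⊆ B) : ProdZero A k :=
  fun a l ha hl hlen => hB a l (h ha) (fun x hx => h (hl x hx)) hlen

theorem mul_left_mem_radical {S : Type*} [SemigroupWithZero S] {x : S} (u : S)
    (hx : x ∈ radical S) : u * x ∈ radical S := by
  obtain ⟨k, hk, h⟩ := hx
  refine ⟨k, hk, h.mono ?_⟩
  rintro y (rfl | (⟨v, rfl⟩ | ⟨v, rfl⟩) | ⟨v, w, rfl⟩)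
  · exact Or.inr (Or.inl (Or.inl ⟨u, rfl⟩))
  · exact Or.inr (Or.inl (Or.inl ⟨v * u, by simp only [mul_assoc]⟩))
  · exact Or.inr (Or.inr ⟨u, v, rfl⟩)
  · exact Or.inr (Or.inr ⟨v * u, w, by simp only [mul_assoc]⟩)

theorem mul_right_mem_radical {S : Type*} [SemigroupWithZero S] {x : S} (u : S)
    (hx : x ∈ radical S) : x * u ∈ radical S := by
  obtain ⟨k, hk, h⟩ := hx
  refine ⟨k, hk, h.mono ?_⟩
  rintro y (rfl | (⟨v, rfl⟩ | ⟨v, rfl⟩) | ⟨v, w, rfl⟩)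
  · exact Or.inr (Or.inl (Or.inr ⟨u, rfl⟩))
  · exact Or.inr (Or.inr ⟨v, u, by simp only [mul_assoc]⟩)
  · exact Or.inr (Or.inl (Or.inr ⟨u * v, by simp only [mul_assoc]⟩))
  · exact Or.inr (Or.inr ⟨v, u * w, by simp only [mul_assoc]⟩)

theorem zero_mem_radical {S : Type*} [SemigroupWithZero S] : (0 : S) ∈ radical S := by
  refine ⟨1, le_rfl, fun a l ha _ hlen => ?_⟩
  obtain rfl : l = [] := List.length_eq_zero_iff.mp (by omega)
  simpa [pId, prodl] using ha

theorem prodl_mem_radical_of_mem {S : Type*} [SemigroupWithZero S] {a : S}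
    (ha : a ∈ radical S) (l : List S) : prodl a l ∈ radical S := by
  induction l generalizing a with
  | nil => exact ha
  | cons b l ih => exact ih (mul_right_mem_radical b ha)

theorem prodl_mem_radical_of_exists {S : Type*} [SemigroupWithZero S] {a y : S} {l : List S}
    (hy : y ∈ l) (hyR : y ∈ radical S) : prodl a l ∈ radical S := by
  obtain ⟨p, q, rfl⟩ := List.append_of_mem hy
  rw [prodl_append_cons]
  exact mul_left_mem_radical _ (prodl_mem_radical_of_mem hyR q)

theorem prodl_mem_radical_of_union {S : Type*} [SemigroupWithZero S] {T : Set S} {m : ℕ}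
    (hT : ProdZero T m) (a : S) (l : List S) (ha : a ∈ T ∪ radical S)
    (hl : ∀ x ∈ l, x ∈ T ∪ radical S) (hlen : l.length + 1 = m) :
    prodl a l ∈ radical S := by
  by_cases haR : a ∈ radical S
  · exact prodl_mem_radical_of_mem haR l
  by_cases hlR : ∃ y ∈ l, y ∈ radical S
  · obtain ⟨y, hy, hyR⟩ := hlR
    exact prodl_mem_radical_of_exists hy hyR
  · push Not at hlR
    rw [hT a l (ha.resolve_right haR) (fun x hx => (hl x hx).resolve_right (hlR x hx)) hlen]
    exact zero_mem_radical

theorem IsNilpSubsgp.union_radical {S : Type*} [SemigroupWithZero S] {T : Set S}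
    (hT : IsNilpSubsgp T) (hR : ∃ k : ℕ, 1 ≤ k ∧ ProdZero (radical S) k) :
    IsNilpSubsgp (T ∪ radical S) := by
  obtain ⟨hmul, m, hm, hTm⟩ := hT
  obtain ⟨k, hk, hRk⟩ := hR
  obtain ⟨k, rfl⟩ := Nat.exists_eq_add_of_le' hk
  refine ⟨?_, (k + 1) * m, Nat.mul_pos k.succ_pos hm, ?_⟩
  · rintro a b (ha | ha) (hb | hb)
    · exact Or.inl (hmul ha hb)
    · exact Or.inr (mul_left_mem_radical a hb)
    · exact Or.inr (mul_right_mem_radical b ha)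
    · exact Or.inr (mul_right_mem_radical b ha)
  · intro a l ha hl hlen
    obtain ⟨b, l', hb, hl', hlen', hprod⟩ :=
      exists_prodl_eq_of_blocks hm (prodl_mem_radical_of_union hTm) k a l ha hl hlen
    rw [hprod]
    exact hRk b l' hb hl' (by rw [hlen'])

/-- Let `S` be a semigroup with zero such that the radical
`R(S)` is a nilpotent semigroup. Then every maximal nilpotent subsemigroup of
`S` contains `R(S)`; in particular `R(S)` is contained in the intersection of
all maximal nilpotent subsemigroups of `S`. -/
theorem statement7 {S : Type*} [SemigroupWithZero S]
    (hR : ∃ k : ℕ, 1 ≤ k ∧ ProdZero (radical S) k) :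
    ∀ T : Set S, IsMaxNilpSubsgp T → radical S ⊆ T := by
  intro T hT
  rw [← hT.2 _ (hT.1.union_radical hR) Set.subset_union_left]
  exact Set.subset_union_right
end

section
/- Let S be a finite semigroup with a zero element 0 such that R(S) = {0}, let e, f be minimal idempotents of S, and suppose that exf ≠ 0 for some x ∈ S¹ (that is, exf ≠ 0 for some x ∈ S, or ef ≠ 0). Then (e) = (f) = (exf); in other words, e and f lie in the same D-class and exf lies in that same D-class. -/
theorem self_mem_pId {S : Type*} [Mul S] (a : S) : a ∈ pId a := Or.inl rfl

theorem mul_left_mem_pId {S : Type*} [Semigroup S] {a b : S} (u : S) (h : b ∈ pId a) :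
    u * b ∈ pId a := by
  rcases h with rfl | (⟨v, rfl⟩ | ⟨v, rfl⟩) | ⟨v, w, rfl⟩
  · exact Or.inr (Or.inl (Or.inl ⟨u, rfl⟩))
  · exact Or.inr (Or.inl (Or.inl ⟨u * v, (mul_assoc u v a).symm⟩))
  · exact Or.inr (Or.inr ⟨u, v, (mul_assoc u a v).symm⟩)
  · exact Or.inr (Or.inr ⟨u * v, w, by simp only [mul_assoc]⟩)

theorem mul_right_mem_pId {S : Type*} [Semigroup S] {a b : S} (u : S) (h : b ∈ pId a) :
    b * u ∈ pId a := by
  rcases h with rfl | (⟨v, rfl⟩ | ⟨v, rfl⟩) | ⟨v, w, rfl⟩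
  · exact Or.inr (Or.inl (Or.inr ⟨u, rfl⟩))
  · exact Or.inr (Or.inr ⟨v, u, rfl⟩)
  · exact Or.inr (Or.inl (Or.inr ⟨v * u, mul_assoc a v u⟩))
  · exact Or.inr (Or.inr ⟨v, w * u, by simp only [mul_assoc]⟩)

theorem pId_subset_of_mem {S : Type*} [Semigroup S] {a b : S} (h : b ∈ pId a) :
    pId b ⊆ pId a := by
  rintro y (rfl | (⟨v, rfl⟩ | ⟨v, rfl⟩) | ⟨v, w, rfl⟩)
  · exact h
  · exact mul_left_mem_pId v h
  · exact mul_right_mem_pId v h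
  · exact mul_right_mem_pId w (mul_left_mem_pId v h)

theorem InMinClass.pId_eq_of_mem {S : Type*} [SemigroupWithZero S] {a b : S}
    (ha : InMinClass a) (h : b ∈ pId a) (hb : b ≠ 0) : pId b = pId a :=
  (ha.2 b (pId_subset_of_mem h)).resolve_left hb

/-- Let `S` be a finite semigroup with zero with `R(S) = {0}`
and let `e, f` be minimal idempotents such that `e * x * f ≠ 0` for some
`x ∈ S¹` (i.e. `e * x * f ≠ 0` for some `x ∈ S`, or `e * f ≠ 0`). Then
`(e) = (f) = (exf)`: `e` and `f` lie in the same D-class and `exf` lies in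
that same D-class. -/
theorem statement9 {S : Type*} [SemigroupWithZero S] [Finite S]
    (hrad : radical S = {0}) (e f : S) (he : MinIdem e) (hf : MinIdem f) :
    (∀ x : S, e * x * f ≠ 0 → pId e = pId f ∧ pId (e * x * f) = pId e) ∧
    (e * f ≠ 0 → pId e = pId f ∧ pId (e * f) = pId e) := by
  have key : ∀ y : S, y ∈ pId e → y ∈ pId f → y ≠ 0 →
      pId e = pId f ∧ pId y = pId e := fun y hye hyf hy =>
    have h := he.2.pId_eq_of_mem hye hy
    ⟨h.symm.trans (hf.2.pId_eq_of_mem hyf hy), h⟩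
  refine ⟨fun x => key _ ?_ ?_, key _ ?_ ?_⟩
  · exact mul_right_mem_pId f (mul_right_mem_pId x (self_mem_pId e))
  · exact mul_left_mem_pId (e * x) (self_mem_pId f)
  · exact mul_right_mem_pId f (self_mem_pId e)
  · exact mul_left_mem_pId e (self_mem_pId f)
end
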